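/- (Finite dependence of inverse data) Fix T ≥ 1. If (a_n, b_n) and (a'_n, b'_n) are two pairs of coefficient sequences (all a_n, a'_n nonzero) with a_k = a'_k for k = 0,…,T−1 and b_k = b'_k for k = 1,…,T, then the corresponding response vectors agree up to index 2T−2: r_s = r'_s for s = 0,…,2T−2. -/

import Mathlib

open Finset Matrix

noncomputable section

/-- `IsWave a b f u` means `u` is the wave of the dynamical system with
off-diagonal coefficients `a = (a_n)_{n ≥ 0}`, diagonal coefficients
`b = (b_n)_{n ≥ 1}` and boundary control `f`:
`u_{n,-1} = u_{n,0} = 0` for `n ≥ 1`, `u_{0,t} = f_t` for `t ≥ 0`, and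
`u_{n,t+1} + u_{n,t-1} - a_n u_{n+1,t} - a_{n-1} u_{n-1,t} - b_n u_{n,t} = 0`
for `n ≥ 1`, `t ≥ 0`. -/
def IsWave (a b f : ℕ → ℂ) (u : ℕ → ℤ → ℂ) : Prop :=
  (∀ n : ℕ, 1 ≤ n → u n (-1) = 0) ∧
  (∀ n : ℕ, 1 ≤ n → u n 0 = 0) ∧
  (∀ t : ℕ, u 0 (t : ℤ) = f t) ∧
  (∀ n : ℕ, 1 ≤ n → ∀ t : ℤ, 0 ≤ t →
    u n (t + 1) + u n (t - 1) - a n * u (n + 1) t - a (n - 1) * u (n - 1) t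
      - b n * u n t = 0)

/-- The special control `δ = (1,0,0,…)`. -/
def deltaCtrl : ℕ → ℂ := fun t => if t = 0 then 1 else 0

/-- Extension of a control `f ∈ ℂ^T` by zero to all of `ℕ`. -/
def extendCtrl (T : ℕ) (f : Fin T → ℂ) : ℕ → ℂ :=
  fun t => if h : t < T then f ⟨t, h⟩ else 0

/-- Finite speed of propagation: a wave vanishes at `(n, t)` whenever `n > t`. -/
theorem IsWave.eq_zero_of_lt {a b f : ℕ → ℂ} {u : ℕ → ℤ → ℂ} (hu : IsWave a b f u)
    {t n : ℕ} (hn : t < n) : u n t = 0 := by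
  obtain ⟨hneg, hzero, -, hrec⟩ := hu
  have key : ∀ t : ℕ, ∀ n : ℕ, 1 ≤ n → (t < n + 1 → u n ((t : ℤ) - 1) = 0) ∧
      (t < n → u n t = 0) := by
    intro t
    induction t with
    | zero => exact fun n hn =>
        ⟨fun _ => by simpa using hneg n hn, fun _ => by simpa using hzero n hn⟩
    | succ t ih =>
      intro n hn
      refine ⟨fun h => ?_, fun h => ?_⟩
      · simpa using (ih n hn).2 (by omega)
      · have h₀ := hrec n hn t (by positivity)
        rw [(ih n hn).1 (by omega), (ih n hn).2 (by omega), (ih (n + 1) (by omega)).2 (by omega),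
          (ih (n - 1) (by omega)).2 (by omega)] at h₀
        push_cast
        linear_combination h₀
  exact (key t n (by omega)).2 hn

/-- Two waves with the same control coincide on the triangle `n + t ≤ 2 * T` when their
coefficients `a_0, …, a_{T-1}` and `b_1, …, b_T` coincide. -/
theorem IsWave.eq_of_add_le {T : ℕ} {a b a' b' f : ℕ → ℂ} {u u' : ℕ → ℤ → ℂ}
    (hagree_a : ∀ k : ℕ, k < T → a k = a' k)
    (hagree_b : ∀ k : ℕ, 1 ≤ k → k ≤ T → b k = b' k)
    (hu : IsWave a b f u) (hu' : IsWave a' b' f u') {t n : ℕ} (hnt : n + t ≤ 2 * T) :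
    u n t = u' n t := by
  have hboundary : ∀ t : ℕ, u 0 t = u' 0 t := fun t => by rw [hu.2.2.1, hu'.2.2.1]
  have key : ∀ t : ℕ, (∀ n : ℕ, 1 ≤ n → n + t ≤ 2 * T + 1 →
      u n ((t : ℤ) - 1) = u' n ((t : ℤ) - 1)) ∧
      ∀ n : ℕ, n + t ≤ 2 * T → u n t = u' n t := by
    intro t
    induction t with
    | zero =>
      refine ⟨fun n hn _ => by simp [hu.1 n hn, hu'.1 n hn], fun n _ => ?_⟩
      rcases Nat.eq_zero_or_pos n with rfl | hn
      · exact hboundary 0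
      · simp [hu.2.1 n hn, hu'.2.1 n hn]
    | succ t ih =>
      refine ⟨fun n _ h => by simpa using ih.2 n (by omega), fun n h => ?_⟩
      rcases Nat.eq_zero_or_pos n with rfl | hn
      · exact hboundary (t + 1)
      have h₀ := hu.2.2.2 n hn t (by positivity)
      have h₀' := hu'.2.2.2 n hn t (by positivity)
      have hprev := ih.1 n hn (by omega)
      have hright : a n * u (n + 1) t = a' n * u' (n + 1) t := by
        rw [← ih.2 (n + 1) (by omega)]
        rcases lt_or_ge n T with hT | hT
        · rw [hagree_a n hT]
        · simp [hu.eq_zero_of_lt (show t < n + 1 by omega)]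
      have hleft : a (n - 1) * u (n - 1) t = a' (n - 1) * u' (n - 1) t := by
        rw [← ih.2 (n - 1) (by omega)]
        rcases lt_or_ge (n - 1) T with hT | hT
        · rw [hagree_a _ hT]
        · simp [hu.eq_zero_of_lt (show t < n - 1 by omega)]
      have hmid : b n * u n t = b' n * u' n t := by
        rw [← ih.2 n (by omega)]
        rcases le_or_gt n T with hT | hT
        · rw [hagree_b n hn hT]
        · simp [hu.eq_zero_of_lt (show t < n by omega)]
      push_cast
      linear_combination h₀ - h₀' - hprev + hright + hleft + hmid
  exact (key t).2 n hnt

/-- finite dependence of inverse data: if two systems have the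
same `a_0,…,a_{T-1}` and `b_1,…,b_T`, their response vectors agree up to index
`2T - 2`. -/
theorem response_finite_dependence
    (T : ℕ) (hT : 1 ≤ T)
    (a b a' b' : ℕ → ℂ) (ha : ∀ n, a n ≠ 0) (ha' : ∀ n, a' n ≠ 0)
    (hagree_a : ∀ k : ℕ, k < T → a k = a' k)
    (hagree_b : ∀ k : ℕ, 1 ≤ k → k ≤ T → b k = b' k)
    (u u' : ℕ → ℤ → ℂ)
    (hu : IsWave a b deltaCtrl u) (hu' : IsWave a' b' deltaCtrl u') :
    ∀ s : ℕ, s ≤ 2 * T - 2 → u 1 ((s : ℤ) + 1) = u' 1 ((s : ℤ) + 1) := by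
  intro s hs
  exact_mod_cast hu.eq_of_add_le hagree_a hagree_b hu' (t := s + 1) (n := 1) (by omega)
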